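/- arXiv:2502.13088 — 6 statements merged into one kernel-verified Lean document; each statement's English description precedes it below -/
import Mathlib

section
/- Let N ≥ 1, let ε1, ε2 be nonzero reals, and let p_i, p̄_i, ξ_{i0}, ξ̄_{i0}, C̃_i, C̄_i, D̃_i, D̄_i be complex parameters with q_i = −p_i/ε1, q̄_i = −p̄_i/ε1, r_i = −p_i/ε2, r̄_i = −p̄_i/ε2 (i.e. p_i = −ε1 q_i = −ε2 r_i and p̄_i = −ε1 q̄_i = −ε2 r̄_i), and assume p_i + p̄_j ≠ 0, q_i + q̄_j ≠ 0, r_i + r̄_j ≠ 0 for all i, j. For (x1, x2, x3, y1, z1) ∈ ℝ⁵ set ξ_i = p_i x1 + p_i² x2 + p_i³ x3 + ξ_{i0}, ξ̄_j = p̄_j x1 − p̄_j² x2 + p̄_j³ x3 + ξ̄_{j0}, η_i = q_i y1, η̄_j = q̄_j y1, χ_i = r_i z1, χ̄_j = r̄_j z1. Define F(x1,x2,x3,y1,z1) = det of the N×N matrix with entries 1/(p_i + p̄_j) + C̃_i C̄_j · exp(η_i + η̄_j − ξ_i − ξ̄_j)/(q_i + q̄_j) + D̃_i D̄_j · exp(χ_i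 + χ̄_j − ξ_i − ξ̄_j)/(r_i + r̄_j). Then ε1 ∂_{y1} F + ε2 ∂_{z1} F = ∂_{x1} F at every point of ℝ⁵. -/
open Complex

/-- Derivative of the determinant at `M` in direction `A`. -/
noncomputable def detDir {N : ℕ} (M A : Fin N → Fin N → ℂ) : ℂ :=
  ∑ σ : Equiv.Perm (Fin N), ((Equiv.Perm.sign σ : ℤ) : ℂ) *
    ∑ i, (∏ j ∈ Finset.univ.erase i, M (σ j) j) * A (σ i) i

lemma hasDerivAt_det_dir {N : ℕ} (M : ℝ → Fin N → Fin N → ℂ) (A : Fin N → Fin N → ℂ) (t : ℝ)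
    (h : ∀ i j, HasDerivAt (fun s => M s i j) (A i j) t) :
    HasDerivAt (fun s => (Matrix.of (M s)).det) (detDir (M t) A) t := by
  simp only [Matrix.det_apply', Matrix.of_apply, detDir]
  refine HasDerivAt.fun_sum fun σ _ => ?_
  refine HasDerivAt.const_mul _ ?_
  have := HasDerivAt.fun_finset_prod (u := Finset.univ) (x := t)
    (f := fun i s => M s (σ i) i) (f' := fun i => A (σ i) i) (fun i _ => h (σ i) i)
  simpa only [smul_eq_mul] using this

lemma detDir_comb {N : ℕ} (M A B : Fin N → Fin N → ℂ) (a b : ℂ) :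
    a * detDir M A + b * detDir M B = detDir M (fun i j => a * A i j + b * B i j) := by
  simp only [detDir, Finset.mul_sum, ← Finset.sum_add_distrib]
  refine Finset.sum_congr rfl fun σ _ => Finset.sum_congr rfl fun i _ => ?_
  ring

/-- Derivative of an exponential with affine exponent. -/
lemma hasDerivAt_exp_aff (a c : ℂ) (g : ℝ → ℂ) (t : ℝ) (hg : ∀ s : ℝ, g s = a * (s : ℂ) + c) :
    HasDerivAt (fun s => Complex.exp (g s)) (Complex.exp (g t) * a) t := by
  have h : HasDerivAt g a t := by
    have h1 := ((Complex.ofRealCLM.hasDerivAt (x := t)).const_mul a).add_const c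
    have h2 : g = fun s : ℝ => a * (s : ℂ) + c := funext hg
    rw [h2]
    simpa using h1
  exact h.cexp

/-- dimension-reduction relation `ε1 ∂_{y1} F + ε2 ∂_{z1} F = ∂_{x1} F`
for the bright-bright soliton τ-function of the coupled Hirota equation. -/
theorem bright_bright_dimension_reduction
    (N : ℕ) (hN : 1 ≤ N) (ε1 ε2 : ℝ) (hε1 : ε1 ≠ 0) (hε2 : ε2 ≠ 0)
    (p pb ξ0 ξb0 Ct Cb Dt Db q qb r rb : Fin N → ℂ)
    (hq : ∀ i, q i = -p i / (ε1 : ℂ)) (hqb : ∀ i, qb i = -pb i / (ε1 : ℂ))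
    (hr : ∀ i, r i = -p i / (ε2 : ℂ)) (hrb : ∀ i, rb i = -pb i / (ε2 : ℂ))
    (hp : ∀ i j, p i + pb j ≠ 0)
    (hq' : ∀ i j, q i + qb j ≠ 0)
    (hr' : ∀ i j, r i + rb j ≠ 0)
    (F : ℝ → ℝ → ℝ → ℝ → ℝ → ℂ)
    (hF : ∀ x1 x2 x3 y1 z1, F x1 x2 x3 y1 z1 =
      (Matrix.of fun i j : Fin N =>
        1 / (p i + pb j)
        + Ct i * Cb j *
            Complex.exp ((q i * (y1 : ℂ) + qb j * (y1 : ℂ))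
              - (p i * (x1 : ℂ) + (p i) ^ 2 * (x2 : ℂ) + (p i) ^ 3 * (x3 : ℂ) + ξ0 i)
              - (pb j * (x1 : ℂ) - (pb j) ^ 2 * (x2 : ℂ) + (pb j) ^ 3 * (x3 : ℂ) + ξb0 j))
            / (q i + qb j)
        + Dt i * Db j *
            Complex.exp ((r i * (z1 : ℂ) + rb j * (z1 : ℂ))
              - (p i * (x1 : ℂ) + (p i) ^ 2 * (x2 : ℂ) + (p i) ^ 3 * (x3 : ℂ) + ξ0 i)
              - (pb j * (x1 : ℂ) - (pb j) ^ 2 * (x2 : ℂ) + (pb j) ^ 3 * (x3 : ℂ) + ξb0 j))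
            / (r i + rb j)).det) :
    ∀ x1 x2 x3 y1 z1 : ℝ,
      (ε1 : ℂ) * deriv (fun y => F x1 x2 x3 y z1) y1
        + (ε2 : ℂ) * deriv (fun z => F x1 x2 x3 y1 z) z1
        = deriv (fun x => F x x2 x3 y1 z1) x1 := by
  intro x1 x2 x3 y1 z1
  have e1 : (ε1 : ℂ) ≠ 0 := by exact_mod_cast hε1
  have e2 : (ε2 : ℂ) ≠ 0 := by exact_mod_cast hε2
  simp only [hF]
  set E1 : Fin N → Fin N → ℂ := fun i j => Complex.exp ((q i * (y1 : ℂ) + qb j * (y1 : ℂ))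
              - (p i * (x1 : ℂ) + (p i) ^ 2 * (x2 : ℂ) + (p i) ^ 3 * (x3 : ℂ) + ξ0 i)
              - (pb j * (x1 : ℂ) - (pb j) ^ 2 * (x2 : ℂ) + (pb j) ^ 3 * (x3 : ℂ) + ξb0 j)) with hE1
  set E2 : Fin N → Fin N → ℂ := fun i j => Complex.exp ((r i * (z1 : ℂ) + rb j * (z1 : ℂ))
              - (p i * (x1 : ℂ) + (p i) ^ 2 * (x2 : ℂ) + (p i) ^ 3 * (x3 : ℂ) + ξ0 i)
              - (pb j * (x1 : ℂ) - (pb j) ^ 2 * (x2 : ℂ) + (pb j) ^ 3 * (x3 : ℂ) + ξb0 j)) with hE2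
  have hy := hasDerivAt_det_dir (fun (y : ℝ) (i j : Fin N) => 1 / (p i + pb j)
        + Ct i * Cb j * Complex.exp ((q i * (y : ℂ) + qb j * (y : ℂ)) - (p i * (x1 : ℂ) + (p i) ^ 2 * (x2 : ℂ) + (p i) ^ 3 * (x3 : ℂ) + ξ0 i)
              - (pb j * (x1 : ℂ) - (pb j) ^ 2 * (x2 : ℂ) + (pb j) ^ 3 * (x3 : ℂ) + ξb0 j)) / (q i + qb j)
        + Dt i * Db j * Complex.exp ((r i * (z1 : ℂ) + rb j * (z1 : ℂ)) - (p i * (x1 : ℂ) + (p i) ^ 2 * (x2 : ℂ) + (p i) ^ 3 * (x3 : ℂ) + ξ0 i)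
              - (pb j * (x1 : ℂ) - (pb j) ^ 2 * (x2 : ℂ) + (pb j) ^ 3 * (x3 : ℂ) + ξb0 j)) / (r i + rb j))
    (fun i j => Ct i * Cb j * E1 i j) y1 (by
      intro i j
      have h := hasDerivAt_exp_aff (q i + qb j) (
              - (p i * (x1 : ℂ) + (p i) ^ 2 * (x2 : ℂ) + (p i) ^ 3 * (x3 : ℂ) + ξ0 i)
              - (pb j * (x1 : ℂ) - (pb j) ^ 2 * (x2 : ℂ) + (pb j) ^ 3 * (x3 : ℂ) + ξb0 j))
        (fun y : ℝ => ((q i * (y : ℂ) + qb j * (y : ℂ)) - (p i * (x1 : ℂ) + (p i) ^ 2 * (x2 : ℂ) + (p i) ^ 3 * (x3 : ℂ) + ξ0 i)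
              - (pb j * (x1 : ℂ) - (pb j) ^ 2 * (x2 : ℂ) + (pb j) ^ 3 * (x3 : ℂ) + ξb0 j))) y1 (fun s => by ring)
      refine ((((h.const_mul (Ct i * Cb j)).div_const (q i + qb j)).const_add _).add_const
        _).congr_deriv ?_
      have := hq' i j
      simp only [hE1]
      field_simp)
  have hz := hasDerivAt_det_dir (fun (z : ℝ) (i j : Fin N) => 1 / (p i + pb j)
        + Ct i * Cb j * Complex.exp ((q i * (y1 : ℂ) + qb j * (y1 : ℂ)) - (p i * (x1 : ℂ) + (p i) ^ 2 * (x2 : ℂ) + (p i) ^ 3 * (x3 : ℂ) + ξ0 i)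
              - (pb j * (x1 : ℂ) - (pb j) ^ 2 * (x2 : ℂ) + (pb j) ^ 3 * (x3 : ℂ) + ξb0 j)) / (q i + qb j)
        + Dt i * Db j * Complex.exp ((r i * (z : ℂ) + rb j * (z : ℂ)) - (p i * (x1 : ℂ) + (p i) ^ 2 * (x2 : ℂ) + (p i) ^ 3 * (x3 : ℂ) + ξ0 i)
              - (pb j * (x1 : ℂ) - (pb j) ^ 2 * (x2 : ℂ) + (pb j) ^ 3 * (x3 : ℂ) + ξb0 j)) / (r i + rb j))
    (fun i j => Dt i * Db j * E2 i j) z1 (by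
      intro i j
      have h := hasDerivAt_exp_aff (r i + rb j) (
              - (p i * (x1 : ℂ) + (p i) ^ 2 * (x2 : ℂ) + (p i) ^ 3 * (x3 : ℂ) + ξ0 i)
              - (pb j * (x1 : ℂ) - (pb j) ^ 2 * (x2 : ℂ) + (pb j) ^ 3 * (x3 : ℂ) + ξb0 j))
        (fun z : ℝ => ((r i * (z : ℂ) + rb j * (z : ℂ)) - (p i * (x1 : ℂ) + (p i) ^ 2 * (x2 : ℂ) + (p i) ^ 3 * (x3 : ℂ) + ξ0 i)
              - (pb j * (x1 : ℂ) - (pb j) ^ 2 * (x2 : ℂ) + (pb j) ^ 3 * (x3 : ℂ) + ξb0 j))) z1 (fun s => by ring)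
      refine (((h.const_mul (Dt i * Db j)).div_const (r i + rb j)).const_add _).congr_deriv ?_
      have := hr' i j
      simp only [hE2]
      field_simp)
  have hx := hasDerivAt_det_dir (fun (x : ℝ) (i j : Fin N) => 1 / (p i + pb j)
        + Ct i * Cb j * Complex.exp ((q i * (y1 : ℂ) + qb j * (y1 : ℂ)) - (p i * (x : ℂ) + (p i) ^ 2 * (x2 : ℂ) + (p i) ^ 3 * (x3 : ℂ) + ξ0 i)
              - (pb j * (x : ℂ) - (pb j) ^ 2 * (x2 : ℂ) + (pb j) ^ 3 * (x3 : ℂ) + ξb0 j)) / (q i + qb j)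
        + Dt i * Db j * Complex.exp ((r i * (z1 : ℂ) + rb j * (z1 : ℂ)) - (p i * (x : ℂ) + (p i) ^ 2 * (x2 : ℂ) + (p i) ^ 3 * (x3 : ℂ) + ξ0 i)
              - (pb j * (x : ℂ) - (pb j) ^ 2 * (x2 : ℂ) + (pb j) ^ 3 * (x3 : ℂ) + ξb0 j)) / (r i + rb j))
    (fun i j => (ε1 : ℂ) * (Ct i * Cb j * E1 i j) + (ε2 : ℂ) * (Dt i * Db j * E2 i j)) x1 (by
      intro i j
      have h1 := hasDerivAt_exp_aff (-(p i + pb j)) (q i * (y1 : ℂ) + qb j * (y1 : ℂ)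
              - ((p i) ^ 2 * (x2 : ℂ) + (p i) ^ 3 * (x3 : ℂ) + ξ0 i)
              - (- (pb j) ^ 2 * (x2 : ℂ) + (pb j) ^ 3 * (x3 : ℂ) + ξb0 j))
        (fun x : ℝ => ((q i * (y1 : ℂ) + qb j * (y1 : ℂ)) - (p i * (x : ℂ) + (p i) ^ 2 * (x2 : ℂ) + (p i) ^ 3 * (x3 : ℂ) + ξ0 i)
              - (pb j * (x : ℂ) - (pb j) ^ 2 * (x2 : ℂ) + (pb j) ^ 3 * (x3 : ℂ) + ξb0 j))) x1 (fun s => by ring)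
      have h2 := hasDerivAt_exp_aff (-(p i + pb j)) (r i * (z1 : ℂ) + rb j * (z1 : ℂ)
              - ((p i) ^ 2 * (x2 : ℂ) + (p i) ^ 3 * (x3 : ℂ) + ξ0 i)
              - (- (pb j) ^ 2 * (x2 : ℂ) + (pb j) ^ 3 * (x3 : ℂ) + ξb0 j))
        (fun x : ℝ => ((r i * (z1 : ℂ) + rb j * (z1 : ℂ)) - (p i * (x : ℂ) + (p i) ^ 2 * (x2 : ℂ) + (p i) ^ 3 * (x3 : ℂ) + ξ0 i)
              - (pb j * (x : ℂ) - (pb j) ^ 2 * (x2 : ℂ) + (pb j) ^ 3 * (x3 : ℂ) + ξb0 j))) x1 (fun s => by ring)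
      refine ((((h1.const_mul (Ct i * Cb j)).div_const (q i + qb j)).const_add _).add
        ((h2.const_mul (Dt i * Db j)).div_const (r i + rb j))).congr_deriv ?_
      have k1 : -(p i + pb j) = (ε1 : ℂ) * (q i + qb j) := by
        rw [hq, hqb]; field_simp; ring
      have k2 : -(p i + pb j) = (ε2 : ℂ) * (r i + rb j) := by
        rw [hr, hrb]; field_simp; ring
      have n1 := hq' i j
      have n2 := hr' i j
      simp only [hE1, hE2]
      congr 1
      · rw [k1]; field_simp
      · rw [k2]; field_simp)
  rw [hy.deriv, hz.deriv, hx.deriv]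
  exact detDir_comb _ _ _ _ _
end

section
/- Let N ≥ 1, let ε1, ε2, ρ1, ρ2 be real, let a, b be complex constants, and let p_i, q_i, d_i, ξ_{i0}, η_{i0} be complex parameters with p_i + q_j ≠ 0, p_i ≠ a, p_i ≠ b, q_i ≠ −a, q_i ≠ −b for all i, j. Suppose that for every i, ε1ρ1²/((p_i − a)(q_i + a)) + ε2ρ2²/((p_i − b)(q_i + b)) = 1. For (x, y, t, r, s) ∈ ℝ⁵ set ξ_i = p_i x + p_i² y + p_i³ t + r/(p_i − a) + s/(p_i − b) + ξ_{i0} and η_j = q_j x − q_j² y + q_j³ t + r/(q_j + a) + s/(q_j + b) + η_{j0}, and for integers k, l let τ_{k,l} = det of the N×N matrix with entries δ_{ij} d_i + (exp(ξ_i + η_j)/(p_i + q_j))·(−(p_i − a)/(q_j + a))^k · (−(p_i − b)/(q_j + b))^l. Then for all integers k, l, (ε1ρ1² ∂_r + ε2ρ2² ∂_s) τ_{k,l} = ∂_x τ_{k,l} at every point of ℝ⁵. -/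
open Complex

lemma det_conj_aux {N : ℕ} (A B : Matrix (Fin N) (Fin N) ℂ) (u : Fin N → ℂ)
    (hu : ∀ i, u i ≠ 0) (h : ∀ i j, A i j * u j = u i * B i j) : A.det = B.det := by
  have h1 : A * Matrix.diagonal u = Matrix.diagonal u * B := by
    ext i j
    rw [Matrix.mul_diagonal, Matrix.diagonal_mul, h]
  have h2 := congrArg Matrix.det h1
  rw [Matrix.det_mul, Matrix.det_mul, Matrix.det_diagonal, mul_comm] at h2
  exact mul_left_cancel₀ (Finset.prod_ne_zero_iff.mpr fun i _ => hu i) h2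

noncomputable def auxF {N : ℕ} (C : Fin N → Fin N → ℂ) (d : Fin N → ℂ) (z : Fin N → ℂ) : ℂ :=
  (Matrix.of fun i j : Fin N => (if i = j then d i else 0) + C i j * Complex.exp (z j)).det

lemma auxF_diff {N : ℕ} (C : Fin N → Fin N → ℂ) (d : Fin N → ℂ) :
    Differentiable ℂ (auxF C d) := by
  unfold auxF
  simp only [Matrix.det_apply, Matrix.of_apply]
  fun_prop

lemma auxF_deriv {N : ℕ} (C : Fin N → Fin N → ℂ) (d : Fin N → ℂ) (z : ℝ → Fin N → ℂ)
    (v : Fin N → ℂ) (x : ℝ) (hz : ∀ j, HasDerivAt (fun x => z x j) (v j) x) :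
    deriv (fun x => auxF C d (z x)) x = fderiv ℂ (auxF C d) (z x) v := by
  have h1 : HasDerivAt z v x := hasDerivAt_pi.mpr hz
  have h2 := ((auxF_diff C d) (z x)).hasFDerivAt.restrictScalars ℝ
  exact (h2.comp_hasDerivAt x h1).deriv

/-- dimension-reduction relation
`(ε1 ρ1² ∂_r + ε2 ρ2² ∂_s) τ_{k,l} = ∂_x τ_{k,l}` for the dark-dark soliton
τ-functions of the coupled Hirota equation in the KP hierarchy. -/
theorem dark_dark_dimension_reduction
    (N : ℕ) (hN : 1 ≤ N) (ε1 ε2 ρ1 ρ2 : ℝ) (a b : ℂ)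
    (p q d ξ0 η0 : Fin N → ℂ)
    (hpq : ∀ i j, p i + q j ≠ 0)
    (hpa : ∀ i, p i ≠ a) (hpb : ∀ i, p i ≠ b)
    (hqa : ∀ i, q i ≠ -a) (hqb : ∀ i, q i ≠ -b)
    (hG : ∀ i, (ε1 * ρ1 ^ 2 : ℂ) / ((p i - a) * (q i + a))
        + (ε2 * ρ2 ^ 2 : ℂ) / ((p i - b) * (q i + b)) = 1)
    (τ : ℤ → ℤ → ℝ → ℝ → ℝ → ℝ → ℝ → ℂ)
    (hτ : ∀ (k l : ℤ) (x y t r s : ℝ), τ k l x y t r s =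
      (Matrix.of fun i j : Fin N =>
        (if i = j then d i else 0)
        + (Complex.exp
              ((p i * (x : ℂ) + (p i) ^ 2 * (y : ℂ) + (p i) ^ 3 * (t : ℂ)
                  + (r : ℂ) / (p i - a) + (s : ℂ) / (p i - b) + ξ0 i)
                + (q j * (x : ℂ) - (q j) ^ 2 * (y : ℂ) + (q j) ^ 3 * (t : ℂ)
                  + (r : ℂ) / (q j + a) + (s : ℂ) / (q j + b) + η0 j))
            / (p i + q j))
            * (-(p i - a) / (q j + a)) ^ k
            * (-(p i - b) / (q j + b)) ^ l).det) :
    ∀ (k l : ℤ) (x y t r s : ℝ),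
      (ε1 * ρ1 ^ 2 : ℂ) * deriv (fun r' => τ k l x y t r' s) r
        + (ε2 * ρ2 ^ 2 : ℂ) * deriv (fun s' => τ k l x y t r s') s
        = deriv (fun x' => τ k l x' y t r s) x := by
  intro k l x y t r s
  have hpa' : ∀ i, p i - a ≠ 0 := fun i => sub_ne_zero.mpr (hpa i)
  have hpb' : ∀ i, p i - b ≠ 0 := fun i => sub_ne_zero.mpr (hpb i)
  have hqa' : ∀ i, q i + a ≠ 0 := fun i h => hqa i (eq_neg_of_add_eq_zero_left h)
  have hqb' : ∀ i, q i + b ≠ 0 := fun i h => hqb i (eq_neg_of_add_eq_zero_left h)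
  let C : Fin N → Fin N → ℂ := fun i j =>
    (-(p j - a) / (q j + a)) ^ k * (-(p j - b) / (q j + b)) ^ l / (p i + q j)
  let z : ℝ → ℝ → ℝ → Fin N → ℂ := fun x r s j =>
    (p j * (x : ℂ) + (p j) ^ 2 * (y : ℂ) + (p j) ^ 3 * (t : ℂ)
                  + (r : ℂ) / (p j - a) + (s : ℂ) / (p j - b) + ξ0 j)
                + (q j * (x : ℂ) - (q j) ^ 2 * (y : ℂ) + (q j) ^ 3 * (t : ℂ)
                  + (r : ℂ) / (q j + a) + (s : ℂ) / (q j + b) + η0 j)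
  have key : ∀ x r s, τ k l x y t r s = auxF C d (z x r s) := by
    intro x r s
    rw [hτ, auxF]
    apply det_conj_aux _ _ (fun i => Complex.exp (p i * (x : ℂ) + (p i) ^ 2 * (y : ℂ)
        + (p i) ^ 3 * (t : ℂ) + (r : ℂ) / (p i - a) + (s : ℂ) / (p i - b) + ξ0 i)
        * (-(p i - a)) ^ k * (-(p i - b)) ^ l)
    · intro i
      exact mul_ne_zero (mul_ne_zero (Complex.exp_ne_zero _)
        (zpow_ne_zero _ (neg_ne_zero.mpr (hpa' i)))) (zpow_ne_zero _ (neg_ne_zero.mpr (hpb' i)))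
    · intro i j
      simp only [Matrix.of_apply, C, z, div_zpow, add_mul, mul_add]
      congr 1
      · split_ifs with h
        · subst h; ring
        · simp
      · simp only [Complex.exp_add (_ + ξ0 _)]
        ring
  have dr : ∀ c : ℂ, ∀ r : ℝ, HasDerivAt (fun r : ℝ => (r : ℂ) / c) (1 / c) r := fun c r =>
    (Complex.ofRealCLM.hasDerivAt (x := r)).div_const c
  have dx : ∀ c : ℂ, ∀ r : ℝ, HasDerivAt (fun r : ℝ => c * (r : ℂ)) c r := fun c r => by
    simpa using (Complex.ofRealCLM.hasDerivAt (x := r)).const_mul c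
  simp only [key]
  rw [auxF_deriv C d (fun r' => z x r' s) (fun j => 1 / (p j - a) + 1 / (q j + a)) r
      fun j => (((dr _ r).const_add _).add_const _ |>.add_const _).add
        (((dr _ r).const_add _).add_const _ |>.add_const _),
    auxF_deriv C d (fun s' => z x r s') (fun j => 1 / (p j - b) + 1 / (q j + b)) s
      fun j => (((dr _ s).const_add _).add_const _).add
        (((dr _ s).const_add _).add_const _),
    auxF_deriv C d (fun x' => z x' r s) (fun j => p j + q j) x
      fun j => (((dx _ x).add_const _ |>.add_const _ |>.add_const _ |>.add_const _ |>.add_const _)).add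
        (((dx _ x).sub_const _ |>.add_const _ |>.add_const _ |>.add_const _ |>.add_const _))]
  rw [← smul_eq_mul (ε1 * ρ1 ^ 2 : ℂ), ← smul_eq_mul (ε2 * ρ2 ^ 2 : ℂ), ← map_smul, ← map_smul, ← map_add]
  congr 1
  ext j
  simp only [Pi.add_apply, Pi.smul_apply, smul_eq_mul]
  have h1 : 1 / (p j - a) + 1 / (q j + a) = (p j + q j) / ((p j - a) * (q j + a)) := by
    have := hpa' j
    have := hqa' j
    field_simp
    ring
  have h2 : 1 / (p j - b) + 1 / (q j + b) = (p j + q j) / ((p j - b) * (q j + b)) := by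
    have := hpb' j
    have := hqb' j
    field_simp
    ring
  rw [h1, h2]
  linear_combination (p j + q j) * hG j
end

section
/- Fix N ≥ 1, real α1, α2, ρ1, ρ2, ε1, ε2 with c = ε1ρ1² + ε2ρ2², an integer h with 0 ≤ h ≤ ⌊N/2⌋, and complex parameters p_i, q_i, d_i, ξ_{i0} such that: p_i = conj(q_i), p_{N+1−i} = conj(q_{N+1−i}), d_i, d_{N+1−i} ∈ ℝ, ξ_{i0}, ξ_{N+1−i,0} ∈ ℝ for 1 ≤ i ≤ h; and p_i = conj(q_{N+1−i}), p_{N+1−i} = conj(q_i), d_i = d_{N+1−i} ∈ ℝ, ξ_{i0} = ξ_{N+1−i,0} ∈ ℝ for h+1 ≤ i ≤ ⌈N/2⌉; with all denominators below nonzero. Set ξ_i(x,t) = p_i(x − 3c t) + p_i³ t + ξ_{i0}, η_j(x,t) = q_j(x − 3c t) + q_j³ t + ξ_{j0}, and τ_{k,l}(x,t) = det of the N×N matrix with entries δ_{ij} d_i exp(−ξ_i − η_j) + (1/(p_i + q_j))·(−(p_i − iα1)/(q_j + iα1))^k · (−(p_i − iα2)/(q_j + iα2))^l. Then for all integers k,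 l and all (x,t) ∈ ℝ², conj(τ_{k,l}(x,t)) = τ_{−k,−l}(x,t). In particular τ_{0,0} is real-valued, conj(τ_{1,0}) = τ_{−1,0}, and conj(τ_{0,1}) = τ_{0,−1}. -/
open Complex

/-- complex-conjugacy relation `conj τ_{k,l} = τ_{−k,−l}` for the
dark-dark soliton τ-functions of the coupled Hirota equation. -/
theorem dark_dark_conjugacy
    (N : ℕ) (hN : 1 ≤ N) (α1 α2 ρ1 ρ2 ε1 ε2 : ℝ)
    (c : ℝ) (hc : c = ε1 * ρ1 ^ 2 + ε2 * ρ2 ^ 2)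
    (p q d ξ0 : Fin N → ℂ)
    (h : ℕ) (hh : h ≤ N / 2)
    (hconj1 : ∀ i : Fin N, (i : ℕ) < h →
      p i = (starRingEnd ℂ) (q i) ∧ p i.rev = (starRingEnd ℂ) (q i.rev) ∧
      (d i).im = 0 ∧ (d i.rev).im = 0 ∧ (ξ0 i).im = 0 ∧ (ξ0 i.rev).im = 0)
    (hconj2 : ∀ i : Fin N, h ≤ (i : ℕ) → (i : ℕ) < (N + 1) / 2 →
      p i = (starRingEnd ℂ) (q i.rev) ∧ p i.rev = (starRingEnd ℂ) (q i) ∧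
      d i = d i.rev ∧ (d i).im = 0 ∧ ξ0 i = ξ0 i.rev ∧ (ξ0 i).im = 0)
    (hpq : ∀ i j, p i + q j ≠ 0)
    (hqα1 : ∀ j, q j + Complex.I * (α1 : ℂ) ≠ 0)
    (hqα2 : ∀ j, q j + Complex.I * (α2 : ℂ) ≠ 0)
    (ξ η : Fin N → ℝ → ℝ → ℂ)
    (hξ : ∀ i x t, ξ i x t = p i * ((x - 3 * c * t : ℝ) : ℂ) + (p i) ^ 3 * (t : ℂ) + ξ0 i)
    (hη : ∀ j x t, η j x t = q j * ((x - 3 * c * t : ℝ) : ℂ) + (q j) ^ 3 * (t : ℂ) + ξ0 j)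
    (τ : ℤ → ℤ → ℝ → ℝ → ℂ)
    (hτ : ∀ k l x t, τ k l x t =
      (Matrix.of fun i j : Fin N =>
        (if i = j then d i * Complex.exp (-ξ i x t - η j x t) else 0)
        + (1 / (p i + q j))
            * (-(p i - Complex.I * (α1 : ℂ)) / (q j + Complex.I * (α1 : ℂ))) ^ k
            * (-(p i - Complex.I * (α2 : ℂ)) / (q j + Complex.I * (α2 : ℂ))) ^ l).det) :
    (∀ (k l : ℤ) (x t : ℝ), (starRingEnd ℂ) (τ k l x t) = τ (-k) (-l) x t) ∧
    (∀ x t : ℝ, (starRingEnd ℂ) (τ 0 0 x t) = τ 0 0 x t) ∧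
    (∀ x t : ℝ, (starRingEnd ℂ) (τ 1 0 x t) = τ (-1) 0 x t) ∧
    (∀ x t : ℝ, (starRingEnd ℂ) (τ 0 1 x t) = τ 0 (-1) x t) := by
  obtain ⟨σ, hσ⟩ : ∃ σ : Equiv.Perm (Fin N), ∀ i, (starRingEnd ℂ) (p i) = q (σ i) ∧
      (starRingEnd ℂ) (q i) = p (σ i) ∧ (starRingEnd ℂ) (d i) = d (σ i) ∧
      (starRingEnd ℂ) (ξ0 i) = ξ0 (σ i) := by
    have hinv : Function.Involutive
        (fun i : Fin N => if (i : ℕ) < h ∨ (i.rev : ℕ) < h then i else i.rev) := by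
      intro i
      by_cases hi : (i : ℕ) < h ∨ (i.rev : ℕ) < h
      · simp only [if_pos hi]
      · have hi' : ¬ ((i.rev : ℕ) < h ∨ (i : ℕ) < h) := by tauto
        simp only [if_neg hi, Fin.rev_rev, if_neg hi']
    refine ⟨hinv.toPerm _, fun i => ?_⟩
    rw [Function.Involutive.coe_toPerm]
    by_cases hi : (i : ℕ) < h ∨ (i.rev : ℕ) < h
    · simp only [if_pos hi]
      rcases hi with hi | hi
      · obtain ⟨a, -, b, -, e, -⟩ := hconj1 i hi
        exact ⟨by rw [a, Complex.conj_conj], a.symm, Complex.conj_eq_iff_im.2 b,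
          Complex.conj_eq_iff_im.2 e⟩
      · obtain ⟨-, a, -, b, -, e⟩ := hconj1 i.rev hi
        rw [Fin.rev_rev] at a b e
        exact ⟨by rw [a, Complex.conj_conj], a.symm, Complex.conj_eq_iff_im.2 b,
          Complex.conj_eq_iff_im.2 e⟩
    · simp only [if_neg hi]
      push Not at hi
      by_cases hl : (i : ℕ) < (N + 1) / 2
      · obtain ⟨a, b, e, f, g, k⟩ := hconj2 i hi.1 hl
        exact ⟨by rw [a, Complex.conj_conj], b.symm, by rw [Complex.conj_eq_iff_im.2 f, e],
          by rw [Complex.conj_eq_iff_im.2 k, g]⟩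
      · obtain ⟨a, b, e, f, g, k⟩ := hconj2 i.rev hi.2 (by rw [Fin.val_rev]; omega)
        rw [Fin.rev_rev] at a b e g
        exact ⟨by rw [b, Complex.conj_conj], a.symm, by rw [← e, Complex.conj_eq_iff_im.2 f],
          by rw [← g, Complex.conj_eq_iff_im.2 k]⟩
  have main : ∀ (k l : ℤ) (x t : ℝ), (starRingEnd ℂ) (τ k l x t) = τ (-k) (-l) x t := by
    intro k l x t
    have key : ∀ (a b : ℂ) (m : ℤ), (-a / b) ^ m = (-b / a) ^ (-m) := by
      intro a b m
      rw [zpow_neg, ← inv_zpow, inv_div, neg_div, div_neg]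
    rw [hτ, hτ, RingHom.map_det, ← Matrix.det_transpose, ← Matrix.det_submatrix_equiv_self σ (Matrix.of _)]
    congr 1
    ext j i
    have hξc : (starRingEnd ℂ) (ξ i x t) = η (σ i) x t := by
      simp only [hξ, hη, map_add, map_mul, map_pow, Complex.conj_ofReal, hσ]
    have hηc : (starRingEnd ℂ) (η j x t) = ξ (σ j) x t := by
      simp only [hξ, hη, map_add, map_mul, map_pow, Complex.conj_ofReal, hσ]
    simp only [Matrix.transpose_apply, RingHom.mapMatrix_apply, Matrix.map_apply,
      Matrix.of_apply, Matrix.submatrix_apply, map_add, map_mul, map_zpow₀, map_div₀, map_neg,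
      map_sub, map_one, Complex.conj_ofReal, Complex.conj_I, hσ, σ.injective.eq_iff]
    congr 1
    · by_cases hij : i = j
      · subst hij
        simp only [if_true, map_mul, ← Complex.exp_conj, map_sub, map_neg, hξc, hηc, hσ]
        congr 2
        ring
      · rw [if_neg hij, if_neg (Ne.symm hij), map_zero]
    · rw [key _ _ k, key _ _ l, add_comm (q (σ i))]
      simp only [neg_mul, sub_neg_eq_add, ← sub_eq_add_neg]
  refine ⟨main, fun x t => ?_, fun x t => ?_, fun x t => ?_⟩
  · simpa using main 0 0 x t
  · simpa using main 1 0 x t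
  · simpa using main 0 1 x t
end

section
/- Let N ≥ 1, let ε1 ≠ 0, ε2, ρ2 be real, let a be a complex constant, and let p_i, p̄_i, ξ_{i0}, ξ̄_{i0}, C̃_i, C̄_i be complex parameters with q_i = (1/ε1)(−p_i + ε2ρ2²/(p_i − a)) and q̄_i = (1/ε1)(−p̄_i + ε2ρ2²/(p̄_i + a)), assuming p_i + p̄_j ≠ 0, q_i + q̄_j ≠ 0, p_i ≠ a, p̄_i ≠ −a for all i, j. For (x1, x2, x3, x_{−1}, y1) ∈ ℝ⁵ set ξ_i = p_i x1 + p_i² x2 + p_i³ x3 + x_{−1}/(p_i − a) + ξ_{i0}, ξ̄_j = p̄_j x1 − p̄_j² x2 + p̄_j³ x3 + x_{−1}/(p̄_j + a) + ξ̄_{j0}, η_i = q_i y1, η̄_j = q̄_j y1, and for integer k define T_k = det of the N×N matrix with entries (1/(p_i + p̄_j))·(−(p_i − a)/(p̄_j + a))^k + C̃_i C̄_j exp(η_i + η̄_j − ξ_i − ξ̄_j)/(q_i + q̄_j). Then for every integer k, ε1 ∂_{y1} T_k + ε2ρ2² ∂_{x_{−1}} T_k = ∂_{x1} T_k at every point of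 ℝ⁵. -/
open Complex

lemma hasDerivAt_det_aux {N : ℕ} (A : ℝ → Matrix (Fin N) (Fin N) ℂ)
    (M A' : Matrix (Fin N) (Fin N) ℂ) (t : ℝ) (hM : A t = M)
    (h : ∀ i j, HasDerivAt (fun s => A s i j) (A' i j) t) :
    HasDerivAt (fun s => (A s).det)
      (∑ σ : Equiv.Perm (Fin N), ((Equiv.Perm.sign σ : ℤ) : ℂ) *
        ∑ i, (∏ j ∈ Finset.univ.erase i, M (σ j) j) * A' (σ i) i) t := by
  subst hM
  simp only [Matrix.det_apply']
  refine HasDerivAt.fun_sum fun σ _ => HasDerivAt.const_mul _ ?_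
  simpa only [smul_eq_mul] using
    HasDerivAt.fun_finset_prod (u := Finset.univ) (fun i _ => h (σ i) i)

lemma hasDerivAt_entry_aux (c d g l : ℂ) (f : ℝ → ℂ) (m : ℂ) (t : ℝ)
    (hf : ∀ s : ℝ, f s = f t + m * ((s : ℂ) - t)) :
    HasDerivAt (fun s => c + d * Complex.exp (f s) / g)
      (m * (d * Complex.exp (f t) / g)) t := by
  have h1 : HasDerivAt f m t := by
    have h0 : HasDerivAt (fun s : ℝ => f t + m * ((s : ℂ) - t)) (m * 1) t :=
      ((((hasDerivAt_id t).ofReal_comp).sub_const _).const_mul m).const_add _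
    rw [mul_one] at h0
    exact h0.congr_of_eventuallyEq (Filter.Eventually.of_forall hf)
  have h2 := (((h1.cexp).const_mul d).div_const g).const_add c
  refine h2.congr_deriv ?_
  ring

/-- dimension-reduction relation
`ε1 ∂_{y1} T_k + ε2 ρ2² ∂_{x_{−1}} T_k = ∂_{x1} T_k` for the bright-dark soliton
τ-functions of the coupled Hirota equation. -/
theorem bright_dark_dimension_reduction
    (N : ℕ) (hN : 1 ≤ N) (ε1 ε2 ρ2 : ℝ) (hε1 : ε1 ≠ 0) (a : ℂ)
    (p pb ξ0 ξb0 Ct Cb q qb : Fin N → ℂ)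
    (hq : ∀ i, q i = (1 / (ε1 : ℂ)) * (-p i + (ε2 * ρ2 ^ 2 : ℂ) / (p i - a)))
    (hqb : ∀ i, qb i = (1 / (ε1 : ℂ)) * (-pb i + (ε2 * ρ2 ^ 2 : ℂ) / (pb i + a)))
    (hppb : ∀ i j, p i + pb j ≠ 0)
    (hqqb : ∀ i j, q i + qb j ≠ 0)
    (hpa : ∀ i, p i ≠ a) (hpba : ∀ i, pb i ≠ -a)
    (T : ℤ → ℝ → ℝ → ℝ → ℝ → ℝ → ℂ)
    (hT : ∀ (k : ℤ) (x1 x2 x3 xm1 y1 : ℝ), T k x1 x2 x3 xm1 y1 =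
      (Matrix.of fun i j : Fin N =>
        (1 / (p i + pb j)) * (-(p i - a) / (pb j + a)) ^ k
        + Ct i * Cb j *
            Complex.exp ((q i * (y1 : ℂ) + qb j * (y1 : ℂ))
              - (p i * (x1 : ℂ) + (p i) ^ 2 * (x2 : ℂ) + (p i) ^ 3 * (x3 : ℂ)
                  + (xm1 : ℂ) / (p i - a) + ξ0 i)
              - (pb j * (x1 : ℂ) - (pb j) ^ 2 * (x2 : ℂ) + (pb j) ^ 3 * (x3 : ℂ)
                  + (xm1 : ℂ) / (pb j + a) + ξb0 j))
            / (q i + qb j)).det) :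
    ∀ (k : ℤ) (x1 x2 x3 xm1 y1 : ℝ),
      (ε1 : ℂ) * deriv (fun y => T k x1 x2 x3 xm1 y) y1
        + (ε2 * ρ2 ^ 2 : ℂ) * deriv (fun w => T k x1 x2 x3 w y1) xm1
        = deriv (fun x => T k x x2 x3 xm1 y1) x1 := by
  intro k x1 x2 x3 xm1 y1
  simp only [hT]
  have hc : (ε1 : ℂ) ≠ 0 := by exact_mod_cast hε1
  set E : Matrix (Fin N) (Fin N) ℂ := Matrix.of fun i j => Ct i * Cb j *
            Complex.exp ((q i * (y1 : ℂ) + qb j * (y1 : ℂ))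
              - (p i * (x1 : ℂ) + (p i) ^ 2 * (x2 : ℂ) + (p i) ^ 3 * (x3 : ℂ)
                  + (xm1 : ℂ) / (p i - a) + ξ0 i)
              - (pb j * (x1 : ℂ) - (pb j) ^ 2 * (x2 : ℂ) + (pb j) ^ 3 * (x3 : ℂ)
                  + (xm1 : ℂ) / (pb j + a) + ξb0 j))
            / (q i + qb j) with hE
  rw [(hasDerivAt_det_aux _ _ (Matrix.of fun i j => (q i + qb j) * E i j) y1 rfl
      (fun i j => hasDerivAt_entry_aux _ _ _ 0 _ _ _ (fun s => by ring))).deriv,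
    (hasDerivAt_det_aux _ _ (Matrix.of fun i j => (-(1 / (p i - a)) - 1 / (pb j + a)) * E i j)
      xm1 rfl
      (fun i j => hasDerivAt_entry_aux _ _ _ 0 _ _ _ (fun s => by ring))).deriv,
    (hasDerivAt_det_aux _ _ (Matrix.of fun i j => (-p i - pb j) * E i j) x1 rfl
      (fun i j => hasDerivAt_entry_aux _ _ _ 0 _ _ _ (fun s => by ring))).deriv]
  rw [Finset.mul_sum, Finset.mul_sum, ← Finset.sum_add_distrib]
  refine Finset.sum_congr rfl fun σ _ => ?_
  rw [mul_left_comm, mul_left_comm (_ * _ : ℂ), ← mul_add, Finset.mul_sum, Finset.mul_sum,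
    ← Finset.sum_add_distrib]
  congr 1
  refine Finset.sum_congr rfl fun i _ => ?_
  have key : (ε1 : ℂ) * (q (σ i) + qb i)
      + (ε2 * ρ2 ^ 2 : ℂ) * (-(1 / (p (σ i) - a)) - 1 / (pb i + a)) = -p (σ i) - pb i := by
    rw [hq, hqb]
    have e : (ε1 : ℂ) * (1 / ε1) = 1 := by field_simp
    linear_combination (-p (σ i) + (ε2 * ρ2 ^ 2 : ℂ) / (p (σ i) - a)
      + (-pb i + (ε2 * ρ2 ^ 2 : ℂ) / (pb i + a))) * e
  rw [Matrix.of_apply, Matrix.of_apply, Matrix.of_apply, ← key]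
  ring
end

section
/- Let N ≥ 1, let ε1 ≠ 0, ε2, ρ2, α2 be real, and let p_i, ξ_{i0}, C_i be complex parameters with q_i = (1/ε1)(−p_i + ε2ρ2²/(p_i − iα2)), assuming all denominators below are nonzero. For (x,t) ∈ ℝ² set ξ_i = p_i(x − 3ε2ρ2² t) + p_i³ t + ξ_{i0}, and for integer k define τ_k^0 = det of the N×N matrix A_k with entries (exp(ξ_i + conj(ξ_j))/(p_i + conj(p_j)))·(−(p_i − iα2)/(conj(p_j) + iα2))^k + conj(C_i) C_j/(q_i + conj(q_j)); define τ_k^1 = det of the bordered (N+1)×(N+1) matrix with upper-left block A_k, last column (((p_1 − iα2)/(−iα2))^k exp(ξ_1), …, ((p_N − iα2)/(−iα2))^k exp(ξ_N), 0)ᵀ and last row (−C_1, …, −C_N, 0); and define τ̄_k^1 = det of the bordered matrix with upper-left block A_k, last column (conj(C_1), …, conj(C_N), 0)ᵀ and last row (−(iα2/(conj(p_1) + iα2))^k exp(conj(ξ_1)), …, −(iα2/(conj(p_N) + iα2))^k exp(conj(ξ_N)), 0). Then for every integer k and all (x,t): conj(τ_k^0) = τ_{−k}^0 and conj(τ_k^1)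 = τ̄_{−k}^1. In particular τ_0^0 is real-valued. -/
open Complex

/-- Bordered (N+1)×(N+1) matrix: upper-left N×N block `M`, last column `col`
(with bottom-right entry 0), last row `row`. -/
noncomputable def border {N : ℕ} (M : Matrix (Fin N) (Fin N) ℂ) (col row : Fin N → ℂ) :
    Matrix (Fin (N + 1)) (Fin (N + 1)) ℂ :=
  Matrix.of fun i j =>
    if hi : (i : ℕ) < N then
      if hj : (j : ℕ) < N then M ⟨i, hi⟩ ⟨j, hj⟩ else col ⟨i, hi⟩
    else if hj : (j : ℕ) < N then row ⟨j, hj⟩ else 0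

/-- Negating both borders does not change the determinant. -/
lemma border_neg_det {N : ℕ} (M : Matrix (Fin N) (Fin N) ℂ) (c r : Fin N → ℂ) :
    (border M (fun i => -c i) (fun j => -r j)).det = (border M c r).det := by
  let v : Fin (N + 1) → ℂ := fun i => if (i : ℕ) < N then 1 else -1
  have h : border M (fun i => -c i) (fun j => -r j)
      = Matrix.diagonal v * border M c r * Matrix.diagonal v := by
    ext i j
    rw [Matrix.mul_diagonal, Matrix.diagonal_mul]
    by_cases hi : (i : ℕ) < N <;> by_cases hj : (j : ℕ) < N <;> simp [border, v, hi, hj]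
  have hv : (∏ i, v i) * (∏ i, v i) = 1 := by
    rw [← Finset.prod_mul_distrib]
    apply Finset.prod_eq_one
    intro i _
    by_cases hi : (i : ℕ) < N <;> simp [v, hi]
  rw [h, Matrix.det_mul, Matrix.det_mul, Matrix.det_diagonal]
  linear_combination (border M c r).det * hv

lemma conj_det_eq {n : ℕ} (M M' : Matrix (Fin n) (Fin n) ℂ)
    (h : ∀ i j, (starRingEnd ℂ) (M i j) = M' j i) : (starRingEnd ℂ) M.det = M'.det := by
  rw [← Matrix.det_transpose M', RingHom.map_det]
  congr 1
  ext i j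
  simpa using h i j

/-- complex-conjugacy relations for the bright-dark soliton
τ-functions of the coupled Hirota equation. -/
theorem bright_dark_conjugacy
    (N : ℕ) (hN : 1 ≤ N) (ε1 ε2 ρ2 α2 : ℝ) (hε1 : ε1 ≠ 0) (hα2 : α2 ≠ 0)
    (p ξ0 C q : Fin N → ℂ)
    (hq : ∀ i, q i = (1 / (ε1 : ℂ))
        * (-p i + (ε2 * ρ2 ^ 2 : ℂ) / (p i - Complex.I * (α2 : ℂ))))
    (hp : ∀ i j, p i + (starRingEnd ℂ) (p j) ≠ 0)
    (hqq : ∀ i j, q i + (starRingEnd ℂ) (q j) ≠ 0)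
    (hpα : ∀ i, p i - Complex.I * (α2 : ℂ) ≠ 0)
    (hpbα : ∀ j, (starRingEnd ℂ) (p j) + Complex.I * (α2 : ℂ) ≠ 0)
    (ξ : Fin N → ℝ → ℝ → ℂ)
    (hξ : ∀ i x t, ξ i x t =
      p i * ((x - 3 * ε2 * ρ2 ^ 2 * t : ℝ) : ℂ) + (p i) ^ 3 * (t : ℂ) + ξ0 i)
    (A : ℤ → ℝ → ℝ → Matrix (Fin N) (Fin N) ℂ)
    (hA : ∀ k x t i j, A k x t i j =
      (Complex.exp (ξ i x t + (starRingEnd ℂ) (ξ j x t)) / (p i + (starRingEnd ℂ) (p j)))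
          * (-(p i - Complex.I * (α2 : ℂ)) / ((starRingEnd ℂ) (p j) + Complex.I * (α2 : ℂ))) ^ k
        + (starRingEnd ℂ) (C i) * C j / (q i + (starRingEnd ℂ) (q j)))
    (τ0 τ1 τb1 : ℤ → ℝ → ℝ → ℂ)
    (hτ0 : ∀ k x t, τ0 k x t = (A k x t).det)
    (hτ1 : ∀ k x t, τ1 k x t =
      (border (A k x t)
        (fun i => ((p i - Complex.I * (α2 : ℂ)) / (-(Complex.I * (α2 : ℂ)))) ^ k
            * Complex.exp (ξ i x t))
        (fun j => -C j)).det)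
    (hτb1 : ∀ k x t, τb1 k x t =
      (border (A k x t)
        (fun i => (starRingEnd ℂ) (C i))
        (fun j => -((Complex.I * (α2 : ℂ) / ((starRingEnd ℂ) (p j) + Complex.I * (α2 : ℂ))) ^ k
            * Complex.exp ((starRingEnd ℂ) (ξ j x t))))).det) :
    (∀ (k : ℤ) (x t : ℝ), (starRingEnd ℂ) (τ0 k x t) = τ0 (-k) x t) ∧
    (∀ (k : ℤ) (x t : ℝ), (starRingEnd ℂ) (τ1 k x t) = τb1 (-k) x t) ∧
    (∀ x t : ℝ, (starRingEnd ℂ) (τ0 0 x t) = τ0 0 x t) := by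
  have hAc : ∀ k x t i j, (starRingEnd ℂ) (A k x t i j) = A (-k) x t j i := by
    intro k x t i j
    rw [hA, hA, zpow_neg, ← inv_zpow]
    simp only [map_add, map_mul, map_div₀, map_zpow₀, map_neg, map_sub, ← Complex.exp_conj,
      Complex.conj_conj, Complex.conj_I, Complex.conj_ofReal, inv_div]
    rw [add_comm ((starRingEnd ℂ) (ξ i x t)), add_comm ((starRingEnd ℂ) (p i)),
      add_comm ((starRingEnd ℂ) (q i)), mul_comm (C i)]
    congr 3
    rw [neg_mul, sub_neg_eq_add, neg_div, div_neg]
    try rw [← sub_eq_add_neg]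
  have h0 : ∀ (k : ℤ) (x t : ℝ), (starRingEnd ℂ) (τ0 k x t) = τ0 (-k) x t := by
    intro k x t
    rw [hτ0, hτ0]
    exact conj_det_eq _ _ (hAc k x t)
  refine ⟨h0, ?_, fun x t => by simpa using h0 0 x t⟩
  intro k x t
  rw [hτ1, hτb1, ← border_neg_det (A (-k) x t)]
  apply conj_det_eq
  intro i j
  by_cases hi : (i : ℕ) < N <;> by_cases hj : (j : ℕ) < N
  · simp [border, hi, hj, hAc]
  · simp only [border, Matrix.of_apply, hi, hj, dif_pos, dif_neg, not_false_eq_true, neg_neg]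
    rw [zpow_neg, ← inv_zpow]
    simp only [map_mul, map_div₀, map_zpow₀, map_neg, map_sub, ← Complex.exp_conj,
      Complex.conj_I, Complex.conj_ofReal, inv_div, neg_mul, neg_neg, sub_neg_eq_add]
  · simp [border, hi, hj]
  · simp [border, hi, hj]
end

section
/- Fix N ≥ 1, ε ∈ ℝ, and complex parameters p_i, ξ_{i0}, C_i, D_i (1 ≤ i ≤ N) with p_i + conj(p_j) ≠ 0 for all i, j, and suppose conj(p_{N+1−i}) = p_i, conj(ξ_{N+1−i,0}) = ξ_{i0}, conj(D_{N+1−i}) = C_i, and conj(D_i) = C_{N+1−i} for all i. With ξ_i(x,t) = p_i x + p_i³ t + ξ_{i0}, m_{ij} = (exp(ξ_i + conj(ξ_j)) − ε·conj(C_i)·C_j − ε·conj(D_i)·D_j)/(p_i + conj(p_j)), f = det(m_{ij}), g1 = det of the bordered matrix with upper-left block (m_{ij}), last column (exp(ξ_1), …, exp(ξ_N), 0)ᵀ and last row (−C_1, …, −C_N, 0), and g2 defined identically with (D_1, …, D_N): then at every (x,t), conj(f) = f and conj(g1) = g2. Consequently the bright-bright cHirota solution u1 = g1/f, u2 = g2/f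 satisfies conj(u1) = u2 wherever f ≠ 0. -/
open Complex

theorem border_cc {N : ℕ} (M : Matrix (Fin N) (Fin N) ℂ) (col row : Fin N → ℂ) (i j : Fin N) :
    border M col row i.castSucc j.castSucc = M i j := by
  simp [border]

theorem border_cl {N : ℕ} (M : Matrix (Fin N) (Fin N) ℂ) (col row : Fin N → ℂ) (i : Fin N) :
    border M col row i.castSucc (Fin.last N) = col i := by
  simp [border]

theorem border_lc {N : ℕ} (M : Matrix (Fin N) (Fin N) ℂ) (col row : Fin N → ℂ) (j : Fin N) :
    border M col row (Fin.last N) j.castSucc = row j := by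
  simp [border]

theorem border_ll {N : ℕ} (M : Matrix (Fin N) (Fin N) ℂ) (col row : Fin N → ℂ) :
    border M col row (Fin.last N) (Fin.last N) = 0 := by
  simp [border]

/-- Reversal of the first `N` indices, fixing the last one. -/
def revFix (N : ℕ) : Equiv.Perm (Fin (N + 1)) :=
  (finSuccEquivLast.trans (Equiv.optionCongr Fin.revPerm)).trans finSuccEquivLast.symm

theorem revFix_castSucc {N : ℕ} (i : Fin N) : revFix N i.castSucc = i.rev.castSucc := by
  simp [revFix]

theorem revFix_last (N : ℕ) : revFix N (Fin.last N) = Fin.last N := by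
  simp [revFix]

theorem conj_det {n : ℕ} (A B : Matrix (Fin n) (Fin n) ℂ) (σ : Equiv.Perm (Fin n))
    (h : ∀ i j, (starRingEnd ℂ) (A i j) = B (σ i) (σ j)) :
    (starRingEnd ℂ) A.det = B.det := by
  rw [← Matrix.det_submatrix_equiv_self σ B, RingHom.map_det]
  congr 1
  ext i j
  simpa using h i j

/-- reduction of the bright-bright soliton of the coupled Hirota
equation (with ε1 = ε2 = ε) to the Sasa-Satsuma equation: `conj f = f`,
`conj g1 = g2`, and hence `conj u1 = u2` wherever `f ≠ 0`. -/
theorem bright_SasaSatsuma_reduction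
    (N : ℕ) (hN : 1 ≤ N) (ε : ℝ) (p ξ0 C D : Fin N → ℂ)
    (hp : ∀ i j, p i + (starRingEnd ℂ) (p j) ≠ 0)
    (hpconj : ∀ i : Fin N, (starRingEnd ℂ) (p i.rev) = p i)
    (hξconj : ∀ i : Fin N, (starRingEnd ℂ) (ξ0 i.rev) = ξ0 i)
    (hCD1 : ∀ i : Fin N, (starRingEnd ℂ) (D i.rev) = C i)
    (hCD2 : ∀ i : Fin N, (starRingEnd ℂ) (D i) = C i.rev)
    (ξ : Fin N → ℝ → ℝ → ℂ)
    (hξ : ∀ i x t, ξ i x t = p i * (x : ℂ) + (p i) ^ 3 * (t : ℂ) + ξ0 i)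
    (M : ℝ → ℝ → Matrix (Fin N) (Fin N) ℂ)
    (hM : ∀ x t i j, M x t i j =
      (Complex.exp (ξ i x t + (starRingEnd ℂ) (ξ j x t))
          - (ε : ℂ) * (starRingEnd ℂ) (C i) * C j
          - (ε : ℂ) * (starRingEnd ℂ) (D i) * D j)
        / (p i + (starRingEnd ℂ) (p j)))
    (f g1 g2 u1 u2 : ℝ → ℝ → ℂ)
    (hf : ∀ x t, f x t = (M x t).det)
    (hg1 : ∀ x t, g1 x t =
      (border (M x t) (fun i => Complex.exp (ξ i x t)) (fun j => -C j)).det)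
    (hg2 : ∀ x t, g2 x t =
      (border (M x t) (fun i => Complex.exp (ξ i x t)) (fun j => -D j)).det)
    (hu1 : ∀ x t, u1 x t = g1 x t / f x t)
    (hu2 : ∀ x t, u2 x t = g2 x t / f x t) :
    (∀ x t : ℝ, (starRingEnd ℂ) (f x t) = f x t) ∧
    (∀ x t : ℝ, (starRingEnd ℂ) (g1 x t) = g2 x t) ∧
    (∀ x t : ℝ, f x t ≠ 0 → (starRingEnd ℂ) (u1 x t) = u2 x t) := by
  have hp' : ∀ i, (starRingEnd ℂ) (p i) = p i.rev := fun i => by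
    simpa using hpconj i.rev
  have hx' : ∀ i, (starRingEnd ℂ) (ξ0 i) = ξ0 i.rev := fun i => by
    simpa using hξconj i.rev
  have hC' : ∀ i, (starRingEnd ℂ) (C i) = D i.rev := fun i => by
    rw [← hCD1 i, Complex.conj_conj]
  have hξ' : ∀ i x t, (starRingEnd ℂ) (ξ i x t) = ξ i.rev x t := fun i x t => by
    simp [hξ, hp', hx']
  have hM' : ∀ x t i j, (starRingEnd ℂ) (M x t i j) = M x t i.rev j.rev := fun x t i j => by
    simp only [hM, map_div₀, map_sub, map_add, map_mul, ← Complex.exp_conj, hξ', hp', hC', hCD2,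
      Complex.conj_ofReal, Fin.rev_rev]
    congr 1
    ring
  have F : ∀ x t : ℝ, (starRingEnd ℂ) (f x t) = f x t := fun x t => by
    rw [hf]
    exact conj_det _ _ Fin.revPerm (fun i j => by simpa using hM' x t i j)
  have G : ∀ x t : ℝ, (starRingEnd ℂ) (g1 x t) = g2 x t := fun x t => by
    rw [hg1, hg2]
    refine conj_det _ _ (revFix N) (fun i j => ?_)
    induction i using Fin.lastCases with
    | last =>
      induction j using Fin.lastCases with
      | last => simp [revFix_last, border_ll]
      | cast j => simp [revFix_last, revFix_castSucc, border_lc, hC']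
    | cast i =>
      induction j using Fin.lastCases with
      | last => simp [revFix_last, revFix_castSucc, border_cl, ← Complex.exp_conj, hξ']
      | cast j => simp [revFix_castSucc, border_cc, hM']
  exact ⟨F, G, fun x t _ => by rw [hu1, hu2, map_div₀, F, G]⟩
end
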